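/- Assume the iterates (x^k, y^k, w^k), k ≥ 0, are generated by LP-ADMM steps with constant penalty parameter ρ > (√3 + 1)·L_f, let (x*, y*, w*) be a KKT point, and set c = (ρ − 2L_f)/4. For an integer K ≥ 1 define the ergodic averages x̄ = (1/K)∑_{k=2}^{K+1} x^k and ȳ = (1/K)∑_{k=2}^{K+1} y^k. Then x̄ ∈ C and f(ȳ) + P(ȳ) − (f(y*) + P(y*)) ≤ (1/K)·[(1/(2ρ))‖w^1‖² + (ρ/2)‖y^1 − y*‖² + c‖y^1 − y^0‖² + B_f(y*, y^{K+1})]; in particular the objective gap at the ergodic averages is O(1/K). -/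

import Mathlib

open scoped RealInnerProductSpace

lemma aux_lin (a b : ℝ) (h : ∀ t : ℝ, 0 < t → t ≤ 1 → 0 ≤ t * a + t ^ 2 * b) : 0 ≤ a := by
  by_contra hneg
  push Not at hneg
  have hb : 0 < |b| + |a| + 1 := by positivity
  have hna : |a| = -a := abs_of_neg hneg
  set t := -a / (2 * (|b| + |a| + 1)) with ht
  have ht0 : 0 < t := div_pos (by linarith) (by linarith)
  have hte : t * (2 * (|b| + |a| + 1)) = -a := by rw [ht]; field_simp
  have hb0 := abs_nonneg b
  have hle : b ≤ |b| := le_abs_self b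
  have ht1 : t ≤ 1 := by
    rw [ht, div_le_one (by linarith)]; linarith
  have := h t ht0 ht1
  have h2 : 0 ≤ a + t * b := by
    by_contra h3
    push Not at h3
    nlinarith
  nlinarith

section
variable {E : Type*} [NormedAddCommGroup E] [InnerProductSpace ℝ E] [CompleteSpace E]

lemma aux_descent (f : E → ℝ) (f' : E → E) (hgrad : ∀ z, HasGradientAt f (f' z) z)
    (L : ℝ) (hlip : ∀ a b, ‖f' a - f' b‖ ≤ L * ‖a - b‖) (a d : E) :
    f (a + d) ≤ f a + ⟪f' a, d⟫ + L / 2 * ‖d‖ ^ 2 := by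
  have hder : ∀ t : ℝ, HasDerivAt (fun t : ℝ => f (a + t • d) - t * ⟪f' a, d⟫
      - L / 2 * t ^ 2 * ‖d‖ ^ 2) (⟪f' (a + t • d), d⟫ - ⟪f' a, d⟫ - L * t * ‖d‖ ^ 2) t := by
    intro t
    have h1 : HasDerivAt (fun t : ℝ => a + t • d) d t := by
      simpa using ((hasDerivAt_id t).smul_const d).const_add a
    have h2 := (hgrad (a + t • d)).hasFDerivAt.comp_hasDerivAt t h1
    have h3 := (h2.sub ((hasDerivAt_id t).mul_const ⟪f' a, d⟫)).sub
      ((((hasDerivAt_id t).pow 2).const_mul (L / 2)).mul_const (‖d‖ ^ 2))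
    refine HasDerivAt.congr_deriv (f := fun t : ℝ => f (a + t • d) - t * ⟪f' a, d⟫
      - L / 2 * t ^ 2 * ‖d‖ ^ 2) h3 ?_
    simp
    left
    ring
  have hanti : AntitoneOn (fun t : ℝ => f (a + t • d) - t * ⟪f' a, d⟫
      - L / 2 * t ^ 2 * ‖d‖ ^ 2) (Set.Icc 0 1) := by
    apply antitoneOn_of_deriv_nonpos (convex_Icc 0 1)
    · exact fun t _ => (hder t).continuousAt.continuousWithinAt
    · exact fun t _ => (hder t).differentiableAt.differentiableWithinAt
    · intro t ht
      rw [interior_Icc] at ht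
      rw [(hder t).deriv, ← inner_sub_left]
      have h1 := real_inner_le_norm (f' (a + t • d) - f' a) d
      have h2 := hlip (a + t • d) a
      rw [add_sub_cancel_left, norm_smul, Real.norm_eq_abs, abs_of_pos ht.1] at h2
      nlinarith [mul_le_mul_of_nonneg_right h2 (norm_nonneg d)]
  have := hanti (Set.left_mem_Icc.2 zero_le_one) (Set.right_mem_Icc.2 zero_le_one) zero_le_one
  simp at this
  linarith

lemma aux_convex (f : E → ℝ) (hf : ConvexOn ℝ Set.univ f)
    (f' : E → E) (hgrad : ∀ z, HasGradientAt f (f' z) z)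
    (L : ℝ) (hlip : ∀ a b, ‖f' a - f' b‖ ≤ L * ‖a - b‖) (u v : E) :
    0 ≤ f u - f v - ⟪f' v, u - v⟫ := by
  apply aux_lin _ (L / 2 * ‖u - v‖ ^ 2)
  intro t ht0 ht1
  have h1 := aux_descent (fun z => - f z) (fun z => - f' z)
    (fun z => by
      have := (hgrad z).hasFDerivAt.neg
      rw [hasGradientAt_iff_hasFDerivAt, map_neg]
      exact this) L
    (fun a b => by
      rw [← neg_sub', norm_neg]; exact hlip a b) v (t • (u - v))
  have h2 := hf.2 (Set.mem_univ v) (Set.mem_univ u) (by linarith : 0 ≤ 1 - t) ht0.le (by ring)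
  have e : (1 - t) • v + t • u = v + t • (u - v) := by module
  rw [e] at h2
  simp only [inner_neg_left, inner_smul_right, norm_smul, smul_eq_mul, mul_pow, Real.norm_eq_abs,
    sq_abs] at h1 h2
  nlinarith

lemma aux_prox (P : E → ℝ) (C : Set E) (hP : ConvexOn ℝ C P) (r : ℝ) (m v : E) (hv : v ∈ C)
    (hmin : IsMinOn (fun z => r / 2 * ‖z - m‖ ^ 2 + P z) C v) (z : E) (hz : z ∈ C) :
    0 ≤ r * ⟪v - m, z - v⟫ + P z - P v := by
  apply aux_lin _ (r / 2 * ‖z - v‖ ^ 2)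
  intro t ht0 ht1
  have hc := hP.1 hv hz (by linarith : 0 ≤ 1 - t) ht0.le (by ring)
  have h2 := hP.2 hv hz (by linarith : 0 ≤ 1 - t) ht0.le (by ring)
  have h1 := hmin hc
  have e : (1 - t) • v + t • z - m = (v - m) + t • (z - v) := by module
  simp only [Set.mem_ofPred_eq] at h1
  rw [e, norm_add_sq_real] at h1
  simp only [inner_smul_right, norm_smul, smul_eq_mul, mul_pow, Real.norm_eq_abs,
    sq_abs] at h1 h2
  nlinarith

/-- the one-step algebraic inequality -/
lemma aux_step (L ρ : ℝ) (hL : 0 < L) (hρ0 : 0 < ρ) (hρL : 2 * L ^ 2 ≤ ρ * (ρ - 2 * L))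
    (y y1 ys w w1 g d0 : E) (D : ℝ)
    (hx : 0 ≤ ⟪ρ • (y1 - y) - w1, ys - y1 - ρ⁻¹ • (w - w1)⟫)
    (hmono : ⟪g, y1 - y⟫ ≤ ⟪w - w1, y1 - y⟫)
    (hg : ‖g‖ ≤ L * ‖d0‖)
    (hF : D ≤ ⟪w1, ys - y1⟫ + L / 2 * ‖y1 - y‖ ^ 2) :
    D ≤ (1 / (2 * ρ) * ‖w‖ ^ 2 + ρ / 2 * ‖y - ys‖ ^ 2 + (ρ - 2 * L) / 4 * ‖d0‖ ^ 2)
      - (1 / (2 * ρ) * ‖w1‖ ^ 2 + ρ / 2 * ‖y1 - ys‖ ^ 2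
        + (ρ - 2 * L) / 4 * ‖y1 - y‖ ^ 2) := by
  obtain ⟨a, ha⟩ : ∃ a, a = w - w1 := ⟨_, rfl⟩
  obtain ⟨d, hd⟩ : ∃ d, d = y1 - y := ⟨_, rfl⟩
  obtain ⟨e, he⟩ : ∃ e, e = ys - y1 := ⟨_, rfl⟩
  have hw : ‖w‖ ^ 2 = ‖w1‖ ^ 2 + 2 * ⟪w1, a⟫ + ‖a‖ ^ 2 := by
    rw [← norm_add_sq_real, ha]; congr 2; abel
  have hy : ‖y - ys‖ ^ 2 = ‖d‖ ^ 2 + 2 * ⟪d, e⟫ + ‖e‖ ^ 2 := by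
    rw [← norm_add_sq_real, hd, he, norm_sub_rev]; congr 2; abel
  have hy1 : ‖y1 - ys‖ = ‖e‖ := by rw [he, norm_sub_rev]
  rw [← hd, ← ha, ← he] at hx
  rw [← hd, ← ha] at hmono
  rw [← hd, ← he] at hF
  rw [hw, hy, hy1, ← hd]
  have hs : 0 ≤ ‖a + (ρ / 2) • d‖ ^ 2 := by positivity
  rw [norm_add_sq_real, inner_smul_right, norm_smul, mul_pow, Real.norm_eq_abs, sq_abs] at hs
  have hgd : -(L * ‖d0‖ * ‖d‖) ≤ ⟪g, d⟫ := by
    have h1 := neg_le_of_abs_le (abs_real_inner_le_norm g d)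
    nlinarith [mul_le_mul_of_nonneg_right hg (norm_nonneg d)]
  simp only [inner_sub_left, inner_sub_right, inner_smul_left, inner_smul_right, conj_trivial] at hx
  rw [real_inner_comm a d] at hx
  have hcan : ρ * (ρ⁻¹ * ⟪a, d⟫) = ⟪a, d⟫ := by field_simp
  have hq : L / 2 * ‖d0‖ * ‖d‖ ≤ ρ / 8 * ‖d‖ ^ 2 + (ρ - 2 * L) / 4 * ‖d0‖ ^ 2 := by
    have : 0 ≤ ρ * (ρ / 8 * ‖d‖ ^ 2 + (ρ - 2 * L) / 4 * ‖d0‖ ^ 2 - L / 2 * ‖d0‖ * ‖d‖) := by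
      nlinarith [sq_nonneg (ρ * ‖d‖ - 2 * L * ‖d0‖),
        mul_le_mul_of_nonneg_right hρL (sq_nonneg ‖d0‖)]
    have := nonneg_of_mul_nonneg_right this hρ0
    linarith
  have hs2 : 0 ≤ ρ⁻¹ / 2 * ‖a‖ ^ 2 + 1 / 2 * ⟪a, d⟫ + ρ / 8 * ‖d‖ ^ 2 := by
    have h := mul_nonneg (by positivity : 0 ≤ ρ⁻¹ / 2) hs
    have e1 : ρ⁻¹ / 2 * (‖a‖ ^ 2 + 2 * (ρ / 2 * ⟪a, d⟫) + (ρ / 2) ^ 2 * ‖d‖ ^ 2)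
      = ρ⁻¹ / 2 * ‖a‖ ^ 2 + 1 / 2 * ⟪a, d⟫ + ρ / 8 * ‖d‖ ^ 2 := by field_simp; ring
    rwa [e1] at h
  have e2 : 1 / (2 * ρ) = ρ⁻¹ / 2 := by field_simp
  rw [e2]
  nlinarith
end

/-- Theorem 4.3(b): `O(1/K)` ergodic rate of LP-ADMM. With
`x̄ = (1/K)∑_{k=2}^{K+1} x^k` and `ȳ = (1/K)∑_{k=2}^{K+1} y^k`, one has `x̄ ∈ C`
and `f(ȳ)+P(ȳ) − (f(y*)+P(y*)) ≤ (1/K)[(1/(2ρ))‖w¹‖² + (ρ/2)‖y¹ − y*‖² +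
c‖y¹ − y⁰‖² + B_f(y*, y^{K+1})]` with `c = (ρ − 2L_f)/4`. -/
theorem lpadmm_ergodic_rate
    {n N : ℕ} (hn : 0 < n) (hN : 0 < N)
    (A : EuclideanSpace ℝ (Fin n) →L[ℝ] EuclideanSpace ℝ (Fin N))
    (C : Set (EuclideanSpace ℝ (Fin n)))
    (hCne : C.Nonempty) (hCconv : Convex ℝ C) (hCclosed : IsClosed C)
    (P : EuclideanSpace ℝ (Fin N) → ℝ) (hP : ConvexOn ℝ Set.univ P)
    (f : EuclideanSpace ℝ (Fin N) → ℝ) (hf : ConvexOn ℝ Set.univ f)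
    (f' : EuclideanSpace ℝ (Fin N) → EuclideanSpace ℝ (Fin N))
    (hgrad : ∀ z, HasGradientAt f (f' z) z)
    (Lf : ℝ) (hLf : 0 < Lf)
    (hlip : ∀ a b, ‖f' a - f' b‖ ≤ Lf * ‖a - b‖)
    (ρ : ℝ) (hρ : (Real.sqrt 3 + 1) * Lf < ρ)
    (x : ℕ → EuclideanSpace ℝ (Fin n)) (y w : ℕ → EuclideanSpace ℝ (Fin N))
    (hx : ∀ k, x (k+1) ∈ C ∧
      IsMinOn (fun u => ‖A u - y k - ρ⁻¹ • w k‖ ^ 2) C (x (k+1)))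
    (hy : ∀ k, IsMinOn
      (fun z => ρ / 2 * ‖z - (A (x (k+1)) - ρ⁻¹ • (w k + f' (y k)))‖ ^ 2 + P z)
      Set.univ (y (k+1)))
    (hw : ∀ k, w (k+1) = w k - ρ • (A (x (k+1)) - y (k+1)))
    (Bf : EuclideanSpace ℝ (Fin N) → EuclideanSpace ℝ (Fin N) → ℝ)
    (hBf : ∀ u v, Bf u v = f u - f v - ⟪f' v, u - v⟫)
    (xs : EuclideanSpace ℝ (Fin n)) (ys ws : EuclideanSpace ℝ (Fin N))
    (hxsC : xs ∈ C) (hAxs : A xs = ys)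
    (hkkt_x : ∀ xx ∈ C, ⟪ws, A xx - A xs⟫ ≤ 0)
    (hkkt_y : ∀ z, P ys + ⟪-ws - f' ys, z - ys⟫ ≤ P z)
    (K : ℕ) (hK : 1 ≤ K)
    (xbar : EuclideanSpace ℝ (Fin n)) (ybar : EuclideanSpace ℝ (Fin N))
    (hxbar : xbar = (K : ℝ)⁻¹ • ∑ k ∈ Finset.Icc 2 (K+1), x k)
    (hybar : ybar = (K : ℝ)⁻¹ • ∑ k ∈ Finset.Icc 2 (K+1), y k) :
    xbar ∈ C ∧
      f ybar + P ybar - (f ys + P ys) ≤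
        (1 / (K : ℝ)) * (1 / (2 * ρ) * ‖w 1‖ ^ 2 + ρ / 2 * ‖y 1 - ys‖ ^ 2
          + (ρ - 2 * Lf) / 4 * ‖y 1 - y 0‖ ^ 2 + Bf ys (y (K+1))) := by
  have hs3 : 0 < Real.sqrt 3 := by positivity
  have hs3' : Real.sqrt 3 ^ 2 = 3 := Real.sq_sqrt (by norm_num)
  have hρ0 : 0 < ρ := lt_trans (by positivity) hρ
  have hρL : 2 * Lf ^ 2 ≤ ρ * (ρ - 2 * Lf) := by
    have h1 : 0 < Real.sqrt 3 * Lf := by positivity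
    have h2 : (Real.sqrt 3 * Lf) ^ 2 ≤ (ρ - Lf) ^ 2 :=
      pow_le_pow_left₀ h1.le (by linarith) 2
    rw [mul_pow, hs3'] at h2
    nlinarith
  have hρ2 : 0 ≤ ρ - 2 * Lf := by
    by_contra h
    push Not at h
    nlinarith [sq_nonneg Lf]
  have hKpos : (0 : ℝ) < K := by exact_mod_cast hK
  have hconvP : ∀ k z, P (y (k+1)) - P z ≤ ⟪w (k+1) + f' (y k), z - y (k+1)⟫ := by
    intro k z
    have h := aux_prox P Set.univ hP ρ _ _ (Set.mem_univ _) (hy k) z (Set.mem_univ _)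
    have e1 : ρ • (y (k+1) - (A (x (k+1)) - ρ⁻¹ • (w k + f' (y k)))) = w (k+1) + f' (y k) := by
      rw [hw k]
      simp only [smul_sub, smul_add, smul_smul, mul_inv_cancel₀ hρ0.ne', one_smul]
      abel
    rw [← e1, real_inner_smul_left]
    linarith
  have hBnn : ∀ u v, 0 ≤ f u - f v - ⟪f' v, u - v⟫ := aux_convex f hf f' hgrad Lf hlip
  have hstep : ∀ k, f (y (k+2)) + P (y (k+2)) - (f ys + P ys) ≤
      (1 / (2 * ρ) * ‖w (k+1)‖ ^ 2 + ρ / 2 * ‖y (k+1) - ys‖ ^ 2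
        + (ρ - 2 * Lf) / 4 * ‖y (k+1) - y k‖ ^ 2)
      - (1 / (2 * ρ) * ‖w (k+2)‖ ^ 2 + ρ / 2 * ‖y (k+2) - ys‖ ^ 2
        + (ρ - 2 * Lf) / 4 * ‖y (k+2) - y (k+1)‖ ^ 2) := by
    intro k
    apply aux_step Lf ρ hLf hρ0 hρL _ _ _ _ _ (f' (y (k+1)) - f' (y k))
    · obtain ⟨hxC, hxm⟩ := hx (k+1)
      have hAx : A (x (k+2)) = y (k+2) + ρ⁻¹ • (w (k+1) - w (k+2)) := by
        rw [hw (k+1), sub_sub_cancel, smul_smul, inv_mul_cancel₀ hρ0.ne', one_smul]; abel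
      have hmin : IsMinOn (fun z => ρ / 2 * ‖z - (y (k+1) + ρ⁻¹ • w (k+1))‖ ^ 2 + 0)
          (A '' C) (A (x (k+2))) := by
        rintro _ ⟨u, hu, rfl⟩
        have := hxm hu
        simp only [Set.mem_ofPred_eq, sub_sub, add_zero] at this ⊢
        exact mul_le_mul_of_nonneg_left this (by positivity)
      have h := aux_prox (fun _ => 0) (A '' C)
        (convexOn_const 0 (hCconv.linear_image A.toLinearMap)) ρ _ _ ⟨_, hxC, rfl⟩ hmin
        ys ⟨xs, hxsC, hAxs⟩
      have e1 : ρ • (A (x (k+2)) - (y (k+1) + ρ⁻¹ • w (k+1))) = ρ • (y (k+2) - y (k+1)) - w (k+2) := by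
        rw [hAx]
        simp only [smul_sub, smul_add, smul_smul, mul_inv_cancel₀ hρ0.ne', one_smul]
        abel
      have e2 : ys - A (x (k+2)) = ys - y (k+2) - ρ⁻¹ • (w (k+1) - w (k+2)) := by
        rw [hAx]; abel
      rw [← e1, ← e2, real_inner_smul_left]
      linarith
    · have h1 := hconvP (k+1) (y (k+1))
      have h2 := hconvP k (y (k+2))
      have e : y (k+1) - y (k+2) = -(y (k+2) - y (k+1)) := by abel
      rw [show k + 1 + 1 = k + 2 from rfl, e, inner_neg_right] at h1
      simp only [inner_add_left] at h1 h2
      simp only [inner_sub_left]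
      linarith
    · exact hlip _ _
    · have h1 := hconvP (k+1) ys
      have h2 := aux_descent f f' hgrad Lf hlip (y (k+1)) (y (k+2) - y (k+1))
      have h3 := hBnn ys (y (k+1))
      rw [add_sub_cancel] at h2
      rw [show k + 1 + 1 = k + 2 from rfl, inner_add_left] at h1
      simp only [inner_sub_right] at h1 h2 h3 ⊢
      linarith
  have hcard : ∑ _k ∈ Finset.Icc 2 (K+1), (K : ℝ)⁻¹ = 1 := by
    simp; field_simp
  have hsumE : ∀ M : ℕ, ∑ k ∈ Finset.Icc 2 (M+1), (f (y k) + P (y k) - (f ys + P ys)) ≤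
      (1 / (2 * ρ) * ‖w 1‖ ^ 2 + ρ / 2 * ‖y 1 - ys‖ ^ 2
        + (ρ - 2 * Lf) / 4 * ‖y 1 - y 0‖ ^ 2)
      - (1 / (2 * ρ) * ‖w (M+1)‖ ^ 2 + ρ / 2 * ‖y (M+1) - ys‖ ^ 2
        + (ρ - 2 * Lf) / 4 * ‖y (M+1) - y M‖ ^ 2) := by
    intro M
    induction M with
    | zero => simp
    | succ M ih =>
      rw [Finset.sum_Icc_succ_top (by omega)]
      have := hstep M
      rw [show M + 1 + 1 = M + 2 from rfl]
      linarith
  constructor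
  · rw [hxbar, Finset.smul_sum]
    apply hCconv.sum_mem (fun _ _ => by positivity) hcard
    intro k hk
    rw [Finset.mem_Icc] at hk
    obtain ⟨j, rfl⟩ : ∃ j, k = j + 1 := ⟨k - 1, by omega⟩
    exact (hx j).1
  · have hJ := (hf.add hP).map_sum_le (t := Finset.Icc 2 (K+1)) (w := fun _ => (K : ℝ)⁻¹) (p := y)
      (fun _ _ => by positivity) hcard (fun _ _ => Set.mem_univ _)
    rw [← Finset.smul_sum, ← Finset.smul_sum, ← hybar] at hJ
    simp only [Pi.add_apply, smul_eq_mul] at hJ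
    have hS := hsumE K
    have hsub : ∑ k ∈ Finset.Icc 2 (K+1), (f (y k) + P (y k) - (f ys + P ys))
        = ∑ k ∈ Finset.Icc 2 (K+1), (f (y k) + P (y k)) - K * (f ys + P ys) := by
      rw [Finset.sum_sub_distrib]; simp; ring
    rw [hsub] at hS
    have hB := hBnn ys (y (K+1))
    rw [← hBf] at hB
    have hE : 0 ≤ 1 / (2 * ρ) * ‖w (K+1)‖ ^ 2 + ρ / 2 * ‖y (K+1) - ys‖ ^ 2
        + (ρ - 2 * Lf) / 4 * ‖y (K+1) - y K‖ ^ 2 := by positivity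
    rw [one_div (K : ℝ)]
    have hfin := mul_le_mul_of_nonneg_left (a := (K : ℝ)⁻¹)
      (show ∑ k ∈ Finset.Icc 2 (K+1), (f (y k) + P (y k)) - K * (f ys + P ys) ≤
        1 / (2 * ρ) * ‖w 1‖ ^ 2 + ρ / 2 * ‖y 1 - ys‖ ^ 2
          + (ρ - 2 * Lf) / 4 * ‖y 1 - y 0‖ ^ 2 + Bf ys (y (K+1)) by linarith) (by positivity)
    rw [mul_sub, inv_mul_cancel_left₀ hKpos.ne'] at hfin
    linarith
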